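/- arXiv:2509.12527 — 3 statements merged into one kernel-verified Lean document; each statement's English description precedes it below -/
import Mathlib

section
/- Let Y be a finite set, let Q, S, S* be probability mass functions on Y with S(y) ≥ α and S*(y) ≥ α for all y, and let P : Y → (0, ∞). Fix B > 0 and define Δ(T) = Σ_{y} Q(y) · clip_B(log P(y) − log T(y)) for a pmf T on Y. If TV(S, S*) ≤ η, then |Δ(S) − Δ(S*)| ≤ min{B, 2η/α}. -/
open Finset

/-- The clipping operator `clip_B(u) = min(max(u,0),B)`. -/
def clip (B u : ℝ) : ℝ := min (max u 0) B

theorem clip_nonneg {B : ℝ} (hB : 0 ≤ B) (u : ℝ) : 0 ≤ clip B u :=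
  le_min (le_max_right u 0) hB

theorem clip_le (B u : ℝ) : clip B u ≤ B :=
  min_le_right _ _

theorem abs_clip_sub_clip_le (B u v : ℝ) : |clip B u - clip B v| ≤ |u - v| := by
  have h_min := abs_min_sub_min_le_max (max u 0) B (max v 0) B
  have h_max := abs_max_sub_max_le_abs u v 0
  rw [sub_self, abs_zero, max_eq_left (abs_nonneg (max u 0 - max v 0))] at h_min
  exact h_min.trans h_max

theorem log_sub_log_le_abs_sub_div {α s t : ℝ} (hα : 0 < α) (hs : α ≤ s) (ht : α ≤ t) :
    Real.log s - Real.log t ≤ |s - t| / α := by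
  have hs0 : 0 < s := hα.trans_le hs
  have ht0 : 0 < t := hα.trans_le ht
  calc Real.log s - Real.log t = Real.log (s / t) := (Real.log_div hs0.ne' ht0.ne').symm
    _ ≤ s / t - 1 := Real.log_le_sub_one_of_pos (div_pos hs0 ht0)
    _ = (s - t) / t := by field_simp
    _ ≤ |s - t| / t := by gcongr; exact le_abs_self _
    _ ≤ |s - t| / α := by gcongr

theorem abs_log_sub_log_le {α s t : ℝ} (hα : 0 < α) (hs : α ≤ s) (ht : α ≤ t) :
    |Real.log s - Real.log t| ≤ |s - t| / α := by
  refine abs_sub_le_iff.2 ⟨log_sub_log_le_abs_sub_div hα hs ht, ?_⟩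
  rw [abs_sub_comm]
  exact log_sub_log_le_abs_sub_div hα ht hs

/-- Weighted averages of pointwise `c`-close functions are `c`-close. -/
theorem abs_sum_mul_sub_sum_mul_le {Y : Type*} [Fintype Y] {Q f g : Y → ℝ} {c : ℝ}
    (hQ0 : ∀ y, 0 ≤ Q y) (hQ1 : ∑ y, Q y = 1) (hfg : ∀ y, |f y - g y| ≤ c) :
    |∑ y, Q y * f y - ∑ y, Q y * g y| ≤ c := by
  calc |∑ y, Q y * f y - ∑ y, Q y * g y| = |∑ y, Q y * (f y - g y)| := by
        simp only [mul_sub, Finset.sum_sub_distrib]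
    _ ≤ ∑ y, |Q y * (f y - g y)| := Finset.abs_sum_le_sum_abs _ _
    _ ≤ ∑ y, Q y * c := Finset.sum_le_sum fun y _ => by
        rw [abs_mul, abs_of_nonneg (hQ0 y)]
        exact mul_le_mul_of_nonneg_left (hfg y) (hQ0 y)
    _ = c := by rw [← Finset.sum_mul, hQ1, one_mul]

/-- Budget stability under skeleton perturbation: if `S` and `S*` are pmfs lower-bounded by `α`
with total variation distance at most `η`, then the expected clipped information budget
`Δ(T) = Σ_y Q(y) clip_B(log P(y) − log T(y))` satisfies `|Δ(S) − Δ(S*)| ≤ min{B, 2η/α}`. -/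
theorem budget_tv_stability {Y : Type*} [Fintype Y]
    (Q S Sstar : Y → ℝ) (P : Y → ℝ) (B α η : ℝ) (hB : 0 < B) (hα : 0 < α)
    (hQ0 : ∀ y, 0 ≤ Q y) (hQ1 : ∑ y, Q y = 1)
    (hS1 : ∑ y, S y = 1) (hSstar1 : ∑ y, Sstar y = 1)
    (hSα : ∀ y, α ≤ S y) (hSstarα : ∀ y, α ≤ Sstar y)
    (hP : ∀ y, 0 < P y)
    (hTV : (1 / 2) * ∑ y, |S y - Sstar y| ≤ η) :
    |(∑ y, Q y * clip B (Real.log (P y) - Real.log (S y)))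
        - ∑ y, Q y * clip B (Real.log (P y) - Real.log (Sstar y))|
      ≤ min B (2 * η / α) := by
  refine abs_sum_mul_sub_sum_mul_le hQ0 hQ1 fun y => le_min ?_ ?_
  · exact abs_sub_le_of_nonneg_of_le (clip_nonneg hB.le _) (clip_le B _)
      (clip_nonneg hB.le _) (clip_le B _)
  · have h_le : |S y - Sstar y| ≤ 2 * η := by
      have h_single := Finset.single_le_sum (f := fun z => |S z - Sstar z|)
        (fun z _ => abs_nonneg _) (Finset.mem_univ y)
      linarith
    calc _ ≤ |(Real.log (P y) - Real.log (S y)) - (Real.log (P y) - Real.log (Sstar y))| :=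
          abs_clip_sub_clip_le B _ _
      _ = |Real.log (S y) - Real.log (Sstar y)| := by rw [sub_sub_sub_cancel_left, abs_sub_comm]
      _ ≤ |S y - Sstar y| / α := abs_log_sub_log_le hα (hSα y) (hSstarα y)
      _ ≤ 2 * η / α := by gcongr
end

section
/- Let (Ω, 𝔽, P) be a probability space carrying an event W (the error event) and real random variables X and Y with |X − Y| ≤ ε almost surely. Suppose the law of X has a Lebesgue density bounded by L, P[X ≥ τ] ≥ q₀ > 0, and 2Lε < q₀. Then P[W | Y ≥ τ] ≤ P[W | X ≥ τ] + 4Lε / (q₀ − 2Lε). -/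
open MeasureTheory ProbabilityTheory

open scoped symmDiff

/-- If the law of `X` has a density bounded by `L`, then `X` lands in `[τ - ε, τ + ε]` with
probability at most `2Lε`. -/
lemma measureReal_abs_sub_le_of_density_le {Ω : Type*} [MeasurableSpace Ω]
    {P : Measure Ω} {X : Ω → ℝ} (hX : Measurable X) {L : ℝ} (hL : 0 ≤ L) {f : ℝ → ℝ}
    (hfL : ∀ x, f x ≤ L)
    (hdens : P.map X = volume.withDensity (fun x => ENNReal.ofReal (f x)))
    (τ : ℝ) {ε : ℝ} (hε : 0 ≤ ε) :
    P.real {ω | |X ω - τ| ≤ ε} ≤ 2 * L * ε := by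
  have hset : {ω | |X ω - τ| ≤ ε} = X ⁻¹' Set.Icc (τ - ε) (τ + ε) := by
    ext ω
    simp only [Set.mem_ofPred_eq, Set.mem_preimage, Set.mem_Icc, abs_le]
    constructor <;> rintro ⟨h₁, h₂⟩ <;> constructor <;> linarith
  refine ENNReal.toReal_le_of_le_ofReal (by positivity) ?_
  rw [hset, ← Measure.map_apply hX measurableSet_Icc, hdens,
    withDensity_apply _ measurableSet_Icc]
  calc ∫⁻ x in Set.Icc (τ - ε) (τ + ε), ENNReal.ofReal (f x)
      ≤ ∫⁻ _ in Set.Icc (τ - ε) (τ + ε), ENNReal.ofReal L :=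
        lintegral_mono fun x => ENNReal.ofReal_le_ofReal (hfL x)
    _ = ENNReal.ofReal (2 * L * ε) := by
        rw [setLIntegral_const, Real.volume_Icc, ← ENNReal.ofReal_mul hL]
        congr 1
        ring

/-- Conditional probabilities are stable under changing the conditioning event on a set of small
measure. -/
lemma cond_real_le_add_of_symmDiff_le {Ω : Type*} [MeasurableSpace Ω]
    {P : Measure Ω} [IsFiniteMeasure P] {A B : Set Ω} (hA : MeasurableSet A)
    (hB : MeasurableSet B) (W : Set Ω) {d q : ℝ} (hAB : P.real (A ∆ B) ≤ d)
    (hq : q ≤ P.real A) (hd : d < q) :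
    (P[|B]).real W ≤ (P[|A]).real W + 2 * d / (q - d) := by
  have hd0 : 0 ≤ d := measureReal_nonneg.trans hAB
  have hA_le : P.real A ≤ P.real B + d := by
    have hsub : A ⊆ B ∪ A ∆ B := fun ω hω => by
      by_cases h : ω ∈ B
      · exact Or.inl h
      · exact Or.inr (Or.inl ⟨hω, h⟩)
    linarith [measureReal_mono (μ := P) hsub, measureReal_union_le (μ := P) B (A ∆ B)]
  have hBW_le : P.real (B ∩ W) ≤ P.real (A ∩ W) + d := by
    have hsub : B ∩ W ⊆ A ∩ W ∪ A ∆ B := fun ω hω => by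
      by_cases h : ω ∈ A
      · exact Or.inl ⟨h, hω.2⟩
      · exact Or.inr (Or.inr ⟨hω.1, h⟩)
    linarith [measureReal_mono (μ := P) hsub, measureReal_union_le (μ := P) (A ∩ W) (A ∆ B)]
  have hAW : P.real (A ∩ W) ≤ P.real A := measureReal_mono Set.inter_subset_left
  have ha : 0 < P.real A := by linarith
  have hb : 0 < P.real B := by linarith
  have hcond {s : Set Ω} (hs : MeasurableSet s) :
      (P[|s]).real W = (P.real s)⁻¹ * P.real (s ∩ W) := by
    simp only [measureReal_def, cond_apply hs, ENNReal.toReal_mul, ENNReal.toReal_inv]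
  rw [hcond hB, hcond hA]
  set r := (P.real A)⁻¹ * P.real (A ∩ W) with hr
  have hr0 : 0 ≤ r := by positivity
  have hr1 : r ≤ 1 := by
    rw [hr, inv_mul_le_iff₀ ha]
    linarith
  have hra : P.real (A ∩ W) = r * P.real A := by
    rw [hr]
    field_simp
  calc (P.real B)⁻¹ * P.real (B ∩ W)
      ≤ r + 2 * d / P.real B := by
        rw [inv_mul_le_iff₀ hb, mul_add, mul_div_cancel₀ _ hb.ne']
        nlinarith
    _ ≤ r + 2 * d / (q - d) := by
        gcongr
        linarith

/-- Stability of the selective risk (conclusion of η-robustness, Theorem 2): if the decision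
statistics `X` and `Y` differ by at most `ε` a.s., the law of `X` has a Lebesgue density
bounded by `L`, `P[X ≥ τ] ≥ q₀ > 0`, and `2Lε < q₀`, then
`P[W | Y ≥ τ] ≤ P[W | X ≥ τ] + 4Lε/(q₀ − 2Lε)`. -/
theorem selective_risk_stability {Ω : Type*} [MeasurableSpace Ω]
    (P : Measure Ω) [IsProbabilityMeasure P]
    (W : Set Ω) (hW : MeasurableSet W)
    (X Y : Ω → ℝ) (hX : Measurable X) (hY : Measurable Y)
    (ε : ℝ) (hclose : ∀ᵐ ω ∂P, |X ω - Y ω| ≤ ε)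
    (L : ℝ) (f : ℝ → ℝ) (hf : Measurable f)
    (hf0 : ∀ x, 0 ≤ f x) (hfL : ∀ x, f x ≤ L)
    (hdens : P.map X = volume.withDensity (fun x => ENNReal.ofReal (f x)))
    (τ q₀ : ℝ) (hq₀ : 0 < q₀)
    (hacc : ENNReal.ofReal q₀ ≤ P {ω | τ ≤ X ω})
    (hgap : 2 * L * ε < q₀) :
    (P[|{ω | τ ≤ Y ω}]) W
      ≤ (P[|{ω | τ ≤ X ω}]) W + ENNReal.ofReal (4 * L * ε / (q₀ - 2 * L * ε)) := by
  obtain ⟨ω₀, hω₀⟩ := hclose.exists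
  have hε : 0 ≤ ε := (abs_nonneg _).trans hω₀
  have hL : 0 ≤ L := (hf0 0).trans (hfL 0)
  have hA : MeasurableSet {ω | τ ≤ X ω} := measurableSet_le measurable_const hX
  have hB : MeasurableSet {ω | τ ≤ Y ω} := measurableSet_le measurable_const hY
  have hsymm : P.real ({ω | τ ≤ X ω} ∆ {ω | τ ≤ Y ω}) ≤ 2 * L * ε := by
    refine le_trans (ENNReal.toReal_mono (measure_ne_top _ _) (measure_mono_ae ?_))
      (measureReal_abs_sub_le_of_density_le hX hL hfL hdens τ hε)
    filter_upwards [hclose] with ω hω hmem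
    change |X ω - τ| ≤ ε
    rw [abs_le] at hω ⊢
    rcases hmem with ⟨h₁, h₂⟩ | ⟨h₁, h₂⟩ <;>
      simp only [Set.mem_ofPred_eq, not_le] at h₁ h₂ <;>
      constructor <;> linarith
  have hq : q₀ ≤ P.real {ω | τ ≤ X ω} :=
    (ENNReal.ofReal_le_iff_le_toReal (measure_ne_top _ _)).1 hacc
  have key := cond_real_le_add_of_symmDiff_le hA hB W hsymm hq hgap
  rw [← ofReal_measureReal (μ := P[|{ω | τ ≤ Y ω}]),
    ← ofReal_measureReal (μ := P[|{ω | τ ≤ X ω}]),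
    ← ENNReal.ofReal_add measureReal_nonneg
      (div_nonneg (by positivity) (by linarith))]
  refine ENNReal.ofReal_le_ofReal (key.trans_eq ?_)
  ring
end

section
/- Let Y be uniform on {0,1} and let E be an observation whose conditional law is P₀ given Y = 0 and P₁ given Y = 1; write P for the joint (uniform mixture) law. Let A be a measurable answer event determined by E with P(A) > 0, and let ψ be a measurable {0,1}-valued predictor determined by E. If h* < 1/2 and the conditional error satisfies P[ψ ≠ Y | A] ≤ h*, then P(A)(1 − 2h*) ≤ TV(P₀, P₁). Consequently, if in addition (1/2)KL(P₀‖M) + (1/2)KL(P₁‖M) ≤ κ with M = (P₀+P₁)/2, the abstention rate satisfies P(Aᶜ) ≥ 1 − √(2κ)/(1 − 2h*). -/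
open MeasureTheory ProbabilityTheory
open scoped ENNReal

/-- The Kullback–Leibler divergence `KL(ρ‖π) = ∫ log (dρ/dπ) dρ` (meaningful when `ρ ≪ π`). -/
noncomputable def klDiv {S : Type*} [MeasurableSpace S] (ρ π : Measure S) : ℝ :=
  ∫ s, Real.log ((ρ.rnDeriv π) s).toReal ∂ρ

/-- The total variation distance `TV(μ,ν) = sup_A |μ(A) − ν(A)|` over measurable sets. -/
noncomputable def tvDist {Ω : Type*} [MeasurableSpace Ω] (μ ν : Measure Ω) : ℝ :=
  ⨆ A : {A : Set Ω // MeasurableSet A}, |(μ A.1).toReal - (ν A.1).toReal|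

/-- Quadratic lower bound for the binary relative entropy with respect to the uniform law. -/
lemma sq_half_sub_le_mul_log_add_mul_log {p q : ℝ} (hp : 0 ≤ p) (hq : 0 ≤ q) (hpq : p + q = 2) :
    ((p - q) / 2) ^ 2 ≤ p * Real.log p + q * Real.log q := by
  have key : ∀ u ∈ Set.Icc (0 : ℝ) 1,
      u ^ 2 ≤ (1 + u) * Real.log (1 + u) + (1 - u) * Real.log (1 - u) := by
    let g : ℝ → ℝ := fun u ↦
      (1 + u) * Real.log (1 + u) + (1 - u) * Real.log (1 - u) - u ^ 2
    have hderiv : ∀ u ∈ Set.Ioo (0 : ℝ) 1,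
        HasDerivAt g (Real.log (1 + u) - Real.log (1 - u) - 2 * u) u := by
      intro u hu
      have hplus := (Real.hasDerivAt_mul_log (x := 1 + u) (by linarith [hu.1])).comp u
        ((hasDerivAt_id u).const_add 1)
      have hminus := (Real.hasDerivAt_mul_log (x := 1 - u) (by linarith [hu.2])).comp u
        ((hasDerivAt_id u).const_sub 1)
      refine ((hplus.add hminus).sub (hasDerivAt_pow 2 u)).congr_deriv ?_
      norm_num
      ring
    have hmono : MonotoneOn g (Set.Icc 0 1) := by
      have hcont : Continuous g :=
        ((Real.continuous_mul_log.comp (continuous_const.add continuous_id)).add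
          (Real.continuous_mul_log.comp (continuous_const.sub continuous_id))).sub
          (continuous_pow 2)
      refine monotoneOn_of_deriv_nonneg (convex_Icc 0 1) hcont.continuousOn ?_ ?_ <;>
        rw [interior_Icc] <;> intro u hu
      · exact (hderiv u hu).differentiableAt.differentiableWithinAt
      · rw [(hderiv u hu).deriv]
        have h := Real.sum_range_le_log_div hu.1.le hu.2 1
        rw [Real.log_div (by linarith [hu.1]) (by linarith [hu.2])] at h
        norm_num at h
        linarith
    intro u hu
    have h := hmono (Set.left_mem_Icc.2 zero_le_one) hu hu.1
    simp only [g] at h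
    norm_num at h
    linarith
  rcases le_total q p with h | h
  · have := key ((p - q) / 2) ⟨by linarith, by linarith⟩
    rwa [show 1 + (p - q) / 2 = p by linarith, show 1 - (p - q) / 2 = q by linarith] at this
  · have := key ((q - p) / 2) ⟨by linarith, by linarith⟩
    rw [show 1 + (q - p) / 2 = q by linarith, show 1 - (q - p) / 2 = p by linarith] at this
    linarith [show ((p - q) / 2) ^ 2 = ((q - p) / 2) ^ 2 by ring]

lemma bddAbove_range_abs_sub_measure {X : Type*} [MeasurableSpace X] (μ ν : Measure X)
    [IsProbabilityMeasure μ] [IsProbabilityMeasure ν] :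
    BddAbove (Set.range fun A : {A : Set X // MeasurableSet A} ↦
      |(μ A.1).toReal - (ν A.1).toReal|) := by
  refine ⟨1, ?_⟩
  rintro _ ⟨A, rfl⟩
  have hμ : (μ A.1).toReal ≤ 1 := measureReal_le_one
  have hν : (ν A.1).toReal ≤ 1 := measureReal_le_one
  exact abs_sub_le_iff.2 ⟨by linarith [(ν A.1).toReal_nonneg],
    by linarith [(μ A.1).toReal_nonneg]⟩

lemma abs_measure_sub_le_tvDist {X : Type*} [MeasurableSpace X] (μ ν : Measure X)
    [IsProbabilityMeasure μ] [IsProbabilityMeasure ν] {B : Set X} (hB : MeasurableSet B) :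
    |μ.real B - ν.real B| ≤ tvDist μ ν :=
  le_ciSup (bddAbove_range_abs_sub_measure μ ν) ⟨B, hB⟩

lemma rnDeriv_add_rnDeriv_mixture {X : Type*} [MeasurableSpace X] (μ ν : Measure X)
    [IsFiniteMeasure μ] [IsFiniteMeasure ν] :
    ∀ᵐ x ∂(((1 : ℝ≥0∞) / 2) • (μ + ν)),
      (μ.rnDeriv (((1 : ℝ≥0∞) / 2) • (μ + ν)) x).toReal +
        (ν.rnDeriv (((1 : ℝ≥0∞) / 2) • (μ + ν)) x).toReal = 2 := by
  set M : Measure X := ((1 : ℝ≥0∞) / 2) • (μ + ν) with hM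
  have : IsFiniteMeasure M := Measure.smul_finite _ (by simp)
  have hsum : μ + ν = (2 : ℝ≥0∞) • M := by
    rw [hM, smul_smul, one_div, ENNReal.mul_inv_cancel two_ne_zero ENNReal.ofNat_ne_top, one_smul]
  have hadd := Measure.rnDeriv_add μ ν M
  rw [hsum] at hadd
  filter_upwards [hadd, Measure.rnDeriv_smul_left_of_ne_top M M (r := 2) ENNReal.ofNat_ne_top,
    M.rnDeriv_self, μ.rnDeriv_lt_top M, ν.rnDeriv_lt_top M] with x h₁ h₂ h₃ h₄ h₅
  rw [h₂] at h₁
  simp only [Pi.smul_apply, h₃, Pi.add_apply, smul_eq_mul, mul_one] at h₁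
  rw [← ENNReal.toReal_add h₄.ne h₅.ne, ← h₁, ENNReal.toReal_ofNat]

/-- Pinsker's inequality for the Jensen–Shannon divergence, on a single event. -/
lemma sq_measure_sub_le_klDiv_add_klDiv {X : Type*} [MeasurableSpace X] (μ ν : Measure X)
    [IsProbabilityMeasure μ] [IsProbabilityMeasure ν] {B : Set X} (hB : MeasurableSet B) :
    (μ.real B - ν.real B) ^ 2 ≤
      klDiv μ (((1 : ℝ≥0∞) / 2) • (μ + ν)) + klDiv ν (((1 : ℝ≥0∞) / 2) • (μ + ν)) := by
  have hsum := rnDeriv_add_rnDeriv_mixture μ ν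
  set M : Measure X := ((1 : ℝ≥0∞) / 2) • (μ + ν) with hM
  have : IsProbabilityMeasure M := by
    refine ⟨?_⟩
    simp [hM, ENNReal.inv_two_add_inv_two]
  have hacM : μ + ν ≪ M := Measure.absolutelyContinuous_smul (by simp)
  have hμM : μ ≪ M := (Measure.AbsolutelyContinuous.rfl.add_right ν).trans hacM
  have hνM : ν ≪ M := by
    rw [add_comm μ ν] at hacM
    exact (Measure.AbsolutelyContinuous.rfl.add_right μ).trans hacM
  let p : X → ℝ := fun x ↦ (μ.rnDeriv M x).toReal
  let q : X → ℝ := fun x ↦ (ν.rnDeriv M x).toReal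
  have hp_meas : Measurable p := (Measure.measurable_rnDeriv _ _).ennreal_toReal
  have hq_meas : Measurable q := (Measure.measurable_rnDeriv _ _).ennreal_toReal
  have hp_nonneg : ∀ x, 0 ≤ p x := fun x ↦ ENNReal.toReal_nonneg
  have hq_nonneg : ∀ x, 0 ≤ q x := fun x ↦ ENNReal.toReal_nonneg
  have hp_int : Integrable p M := Measure.integrable_toReal_rnDeriv
  have hq_int : Integrable q M := Measure.integrable_toReal_rnDeriv
  obtain ⟨C, hC⟩ := (isCompact_Icc (a := (0 : ℝ)) (b := 2)).exists_bound_of_continuousOn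
    Real.continuous_mul_log.continuousOn
  have hpl_int : Integrable (fun x ↦ p x * Real.log (p x)) M := by
    refine Integrable.of_bound (Real.continuous_mul_log.measurable.comp hp_meas).aestronglyMeasurable
      C ?_
    filter_upwards [hsum] with x hx
    exact hC _ ⟨hp_nonneg x, by linarith [hq_nonneg x]⟩
  have hql_int : Integrable (fun x ↦ q x * Real.log (q x)) M := by
    refine Integrable.of_bound (Real.continuous_mul_log.measurable.comp hq_meas).aestronglyMeasurable
      C ?_
    filter_upwards [hsum] with x hx
    exact hC _ ⟨hq_nonneg x, by linarith [hp_nonneg x]⟩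
  have hklμ : klDiv μ M = ∫ x, p x * Real.log (p x) ∂M :=
    (integral_rnDeriv_smul hμM (f := fun x ↦ Real.log (p x))).symm
  have hklν : klDiv ν M = ∫ x, q x * Real.log (q x) ∂M :=
    (integral_rnDeriv_smul hνM (f := fun x ↦ Real.log (q x))).symm
  set d := μ.real B - ν.real B with hd
  have hdiff : Integrable (fun x ↦ p x - q x) M := hp_int.sub hq_int
  have hint : ∫ x, (p x - q x) ∂M = 0 := by
    rw [integral_sub hp_int hq_int, Measure.integral_toReal_rnDeriv hμM,
      Measure.integral_toReal_rnDeriv hνM]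
    simp
  have hintB : ∫ x in B, (p x - q x) ∂M = d := by
    rw [integral_sub hp_int.integrableOn hq_int.integrableOn,
      Measure.setIntegral_toReal_rnDeriv hμM, Measure.setIntegral_toReal_rnDeriv hνM]
  let s : X → ℝ := fun x ↦ 2 * B.indicator (fun x ↦ p x - q x) x - (p x - q x)
  have hs_int : Integrable s M := ((hdiff.indicator hB).const_mul 2).sub hdiff
  have hs : ∫ x, s x ∂M = 2 * d := by
    rw [integral_sub ((hdiff.indicator hB).const_mul 2) hdiff, integral_const_mul,
      integral_indicator hB, hintB, hint, sub_zero]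
  calc d ^ 2 = ∫ x, (d * s x - d ^ 2) ∂M := by
        rw [integral_sub (hs_int.const_mul d) (integrable_const _), integral_const_mul, hs]
        simp
        ring
    _ ≤ ∫ x, (p x * Real.log (p x) + q x * Real.log (q x)) ∂M := by
        refine integral_mono_ae ((hs_int.const_mul d).sub (integrable_const _))
          (hpl_int.add hql_int) ?_
        filter_upwards [hsum] with x hx
        refine le_trans ?_
          (sq_half_sub_le_mul_log_add_mul_log (hp_nonneg x) (hq_nonneg x) hx)
        by_cases hxB : x ∈ B
        · simp only [s, Set.indicator_of_mem hxB]
          linarith [sq_nonneg ((p x - q x) / 2 - d)]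
        · simp only [s, Set.indicator_of_notMem hxB]
          linarith [sq_nonneg ((p x - q x) / 2 + d)]
    _ = klDiv μ M + klDiv ν M := by rw [integral_add hpl_int hql_int, hklμ, hklν]

lemma tvDist_le_sqrt {X : Type*} [MeasurableSpace X] (μ ν : Measure X)
    [IsProbabilityMeasure μ] [IsProbabilityMeasure ν] {κ : ℝ}
    (hκ : (1 / 2) * klDiv μ (((1 : ℝ≥0∞) / 2) • (μ + ν))
      + (1 / 2) * klDiv ν (((1 : ℝ≥0∞) / 2) • (μ + ν)) ≤ κ) :
    tvDist μ ν ≤ Real.sqrt (2 * κ) := by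
  have : Nonempty {A : Set X // MeasurableSet A} := ⟨⟨∅, MeasurableSet.empty⟩⟩
  refine ciSup_le fun B ↦ Real.abs_le_sqrt ?_
  have h := sq_measure_sub_le_klDiv_add_klDiv μ ν B.2
  simp only [measureReal_def] at h
  linarith

lemma measureReal_cond_mul_eq_inter {Ω : Type*} [MeasurableSpace Ω] (P : Measure Ω)
    [IsFiniteMeasure P] {s : Set Ω} (hs : MeasurableSet s) (t : Set Ω) :
    (P[|s]).real t * P.real s = P.real (s ∩ t) := by
  simp only [measureReal_def, ← ENNReal.toReal_mul, cond_mul_eq_inter hs]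

lemma measureReal_inter_preimage_eq_mul_map_cond {Ω X : Type*} [MeasurableSpace Ω]
    [MeasurableSpace X] (P : Measure Ω) [IsFiniteMeasure P] {f : Ω → X} (hf : Measurable f)
    {s : Set Ω} (hs : MeasurableSet s) {B : Set X} (hB : MeasurableSet B) :
    P.real (s ∩ f ⁻¹' B) = P.real s * ((P[|s]).map f).real B := by
  rw [map_measureReal_apply hf hB, mul_comm, measureReal_cond_mul_eq_inter P hs]

/-- κ-informativeness lower bound (Theorem 3). `Yv` is a uniform binary label, `Ev` an
observation with conditional laws `P₀` (given `Yv = false`) and `P₁` (given `Yv = true`).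
If a selective predictor `ψ` answering on the event `Ev ⁻¹' A₀` has conditional error at most
`h* < 1/2`, then `P(A)(1 − 2h*) ≤ TV(P₀, P₁)`; consequently, if the evidence carries at most
`κ` nats (`(1/2)KL(P₀‖M) + (1/2)KL(P₁‖M) ≤ κ` for the mixture `M`), the abstention rate is at
least `1 − √(2κ)/(1 − 2h*)`. -/
theorem kappa_informativeness_abstention
    {Ω X : Type*} [MeasurableSpace Ω] [MeasurableSpace X]
    (P : Measure Ω) [IsProbabilityMeasure P]
    (Yv : Ω → Bool) (Ev : Ω → X) (hYv : Measurable Yv) (hEv : Measurable Ev)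
    (P₀ P₁ : Measure X) [IsProbabilityMeasure P₀] [IsProbabilityMeasure P₁]
    (hunif : P {ω | Yv ω = true} = 1 / 2)
    (hcond0 : (P[|{ω | Yv ω = false}]).map Ev = P₀)
    (hcond1 : (P[|{ω | Yv ω = true}]).map Ev = P₁)
    (A₀ : Set X) (hA₀ : MeasurableSet A₀) (hApos : 0 < P (Ev ⁻¹' A₀))
    (ψ : X → Bool) (hψ : Measurable ψ)
    (hstar : ℝ) (hh : hstar < 1 / 2)
    (herr : ((P[|Ev ⁻¹' A₀]) {ω | ψ (Ev ω) ≠ Yv ω}).toReal ≤ hstar) :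
    (P (Ev ⁻¹' A₀)).toReal * (1 - 2 * hstar) ≤ tvDist P₀ P₁ ∧
    (∀ κ : ℝ,
      (1 / 2) * klDiv P₀ (((1 : ℝ≥0∞) / 2) • (P₀ + P₁))
          + (1 / 2) * klDiv P₁ (((1 : ℝ≥0∞) / 2) • (P₀ + P₁)) ≤ κ →
      1 - Real.sqrt (2 * κ) / (1 - 2 * hstar) ≤ (P (Ev ⁻¹' A₀)ᶜ).toReal) := by
  have hY1 : MeasurableSet {ω | Yv ω = true} := hYv (measurableSet_singleton true)
  have hY0 : MeasurableSet {ω | Yv ω = false} := hYv (measurableSet_singleton false)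
  have hcompl : {ω | Yv ω = true}ᶜ = {ω | Yv ω = false} := by ext ω; simp
  have hreal1 : P.real {ω | Yv ω = true} = 1 / 2 := by simp [measureReal_def, hunif]
  have hreal0 : P.real {ω | Yv ω = false} = 1 / 2 := by
    rw [← hcompl, probReal_compl_eq_one_sub hY1, hreal1]
    norm_num
  have hjoint0 : ∀ {B : Set X}, MeasurableSet B →
      P.real ({ω | Yv ω = false} ∩ Ev ⁻¹' B) = 1 / 2 * P₀.real B := fun hB ↦ by
    rw [measureReal_inter_preimage_eq_mul_map_cond P hEv hY0 hB, hcond0, hreal0]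
  have hjoint1 : ∀ {B : Set X}, MeasurableSet B →
      P.real ({ω | Yv ω = true} ∩ Ev ⁻¹' B) = 1 / 2 * P₁.real B := fun hB ↦ by
    rw [measureReal_inter_preimage_eq_mul_map_cond P hEv hY1 hB, hcond1, hreal1]
  have hA : MeasurableSet (Ev ⁻¹' A₀) := hEv hA₀
  have hB1 : MeasurableSet (A₀ ∩ ψ ⁻¹' {true}) := hA₀.inter (hψ (measurableSet_singleton _))
  have hB0 : MeasurableSet (A₀ ∩ ψ ⁻¹' {false}) := hA₀.inter (hψ (measurableSet_singleton _))
  have hsplit : ∀ (Q : Measure X) [IsProbabilityMeasure Q],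
      Q.real A₀ = Q.real (A₀ ∩ ψ ⁻¹' {true}) + Q.real (A₀ ∩ ψ ⁻¹' {false}) := by
    intro Q _
    rw [← measureReal_inter_add_sdiff (s := A₀) (hψ (measurableSet_singleton true))]
    congr 2
    ext x
    simp
  have hPA : P.real (Ev ⁻¹' A₀) = 1 / 2 * P₀.real A₀ + 1 / 2 * P₁.real A₀ := by
    rw [← hjoint0 hA₀, ← hjoint1 hA₀, ← measureReal_inter_add_sdiff (s := Ev ⁻¹' A₀) hY0]
    congr 2
    · exact Set.inter_comm _ _
    · ext ω
      simp [and_comm]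
  have herr_eq : P.real (Ev ⁻¹' A₀ ∩ {ω | ψ (Ev ω) ≠ Yv ω}) =
      1 / 2 * P₀.real (A₀ ∩ ψ ⁻¹' {true}) + 1 / 2 * P₁.real (A₀ ∩ ψ ⁻¹' {false}) := by
    rw [← hjoint0 hB1, ← hjoint1 hB0, ← measureReal_inter_add_sdiff hY0]
    congr 2 <;> ext ω <;> cases h : Yv ω <;> simp [h]
  have herr_le : P.real (Ev ⁻¹' A₀ ∩ {ω | ψ (Ev ω) ≠ Yv ω}) ≤
      hstar * P.real (Ev ⁻¹' A₀) := by
    rw [← measureReal_cond_mul_eq_inter P hA]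
    exact mul_le_mul_of_nonneg_right herr measureReal_nonneg
  have hmain : P.real (Ev ⁻¹' A₀) * (1 - 2 * hstar) ≤ tvDist P₀ P₁ := by
    have h1 := (abs_le.1 (abs_measure_sub_le_tvDist P₀ P₁ hB1)).1
    have h0 := (abs_le.1 (abs_measure_sub_le_tvDist P₀ P₁ hB0)).2
    linarith [hsplit P₀, hsplit P₁]
  refine ⟨hmain, fun κ hκ ↦ ?_⟩
  have hpos : 0 < 1 - 2 * hstar := by linarith
  have hle : P.real (Ev ⁻¹' A₀) ≤ Real.sqrt (2 * κ) / (1 - 2 * hstar) :=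
    (le_div_iff₀ hpos).2 (hmain.trans (tvDist_le_sqrt P₀ P₁ hκ))
  change _ ≤ P.real (Ev ⁻¹' A₀)ᶜ
  rw [probReal_compl_eq_one_sub hA]
  linarith
end
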